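/- arXiv:1712.07548 — 5 statements merged into one kernel-verified Lean document; each statement's English description precedes it below -/
import Mathlib

section
/- For all integers k, t with 1 ≤ k ≤ t, the true parameter matrix at time t belongs to the inflated slab generated by the measurement at time k: H(t) ∈ S_k(t), i.e., for every j = 1,…,n_y, −ε_{d_j} − ε_{v_j} + (t−k)·θ̲_j(k) ≤ H_j(t)ᵀφ(k) − ỹ_j(k) ≤ ε_{d_j} + ε_{v_j} + (t−k)·θ̄_j(k). -/
open Matrix

/-- For all integers `1 ≤ k ≤ t`, the true parameter matrix at time `t` belongs to
the inflated slab generated by the measurement at time `k`: for every row `j`,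
`−ε_{d_j} − ε_{v_j} + (t−k)·θ̲_j(k) ≤ H_j(t)ᵀφ(k) − ỹ_j(k) ≤ ε_{d_j} + ε_{v_j} + (t−k)·θ̄_j(k)`. -/
theorem stmt_1
    (ny m : ℕ) (hny : 0 < ny) (hm : 0 < m)
    (H : ℕ → Matrix (Fin ny) (Fin m) ℝ)
    (φ : ℕ → Fin m → ℝ)
    (d v : ℕ → Fin ny → ℝ)
    (εd εv : Fin ny → ℝ)
    (hεd : ∀ j, 0 < εd j) (hεv : ∀ j, 0 < εv j)
    (hd : ∀ t j, |d t j| ≤ εd j)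
    (hv : ∀ t j, |v t j| ≤ εv j)
    (ytil : ℕ → Fin ny → ℝ)
    (hytil : ∀ t, ytil t = (H t).mulVec (φ t) + d t + v t)
    (nΔ : Fin ny → ℕ)
    (K : ∀ j, Matrix (Fin (nΔ j)) (Fin m) ℝ)
    (l : ∀ j, Fin (nΔ j) → ℝ)
    (hD : ∀ t j i, ((K j).mulVec (H (t + 1) j - H t j)) i ≤ l j i)
    (θlo θhi : Fin ny → ℕ → ℝ)
    (hθ : ∀ j k (x : Fin m → ℝ), (∀ i, ((K j).mulVec x) i ≤ l j i) →
      θlo j k ≤ φ k ⬝ᵥ x ∧ φ k ⬝ᵥ x ≤ θhi j k)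
    (k t : ℕ) (hk : 1 ≤ k) (hkt : k ≤ t) :
    ∀ j, -(εd j) - εv j + ((t : ℝ) - (k : ℝ)) * θlo j k ≤ H t j ⬝ᵥ φ k - ytil k j ∧
      H t j ⬝ᵥ φ k - ytil k j ≤ εd j + εv j + ((t : ℝ) - (k : ℝ)) * θhi j k := by
  intro j
  have hyk : ytil k j = H k j ⬝ᵥ φ k + d k j + v k j := by
    rw [hytil k]
    rfl
  have drift : ((t : ℝ) - (k : ℝ)) * θlo j k ≤ H t j ⬝ᵥ φ k - H k j ⬝ᵥ φ k ∧
      H t j ⬝ᵥ φ k - H k j ⬝ᵥ φ k ≤ ((t : ℝ) - (k : ℝ)) * θhi j k := by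
    induction t, hkt using Nat.le_induction with
    | base => simp
    | succ n _ ih =>
      have step := hθ j k (H (n + 1) j - H n j) (hD n j)
      rw [dotProduct_comm, sub_dotProduct] at step
      push_cast
      constructor <;> linarith [ih.1, ih.2, step.1, step.2]
  have hdk := abs_le.mp (hd k j)
  have hvk := abs_le.mp (hv k j)
  rw [hyk]
  constructor <;> linarith [drift.1, drift.2, hdk.1, hdk.2, hvk.1, hvk.2]
end

section
/- (Lemma 2, nonempty membership of the feasible parameter set) For every t ≥ 1 and every subset W ⊆ {1,…,t} of retained measurement indices (in particular the window of the most recent M/2 measurements used by the recursive set membership identification algorithm), the feasible parameter set Ω ∩ ⋂_{k∈W} S_k(t) contains the true parameter matrix H(t); in particular this set is nonempty. -/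
open Matrix

/-- The inflated slab `S_i(k)` generated by the measurement at time `i`,
guaranteed to contain the parameter matrix at time `k ≥ i`. -/
def Sset {ny m : ℕ} (φ : ℕ → Fin m → ℝ) (ytil : ℕ → Fin ny → ℝ)
    (εd εv : Fin ny → ℝ) (θlo θhi : Fin ny → ℕ → ℝ) (i k : ℕ) :
    Set (Matrix (Fin ny) (Fin m) ℝ) :=
  {Hm | ∀ j, -(εd j) - εv j + ((k : ℝ) - (i : ℝ)) * θlo j i ≤ Hm j ⬝ᵥ φ i - ytil i j ∧
        Hm j ⬝ᵥ φ i - ytil i j ≤ εd j + εv j + ((k : ℝ) - (i : ℝ)) * θhi j i}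

/-- The prior polytopic uncertainty set `Ω`. -/
def OmegaSet {ny m : ℕ} {r0 : Fin ny → ℕ}
    (A0 : ∀ j, Matrix (Fin (r0 j)) (Fin m) ℝ) (b0 : ∀ j, Fin (r0 j) → ℝ) :
    Set (Matrix (Fin ny) (Fin m) ℝ) :=
  {Hm | ∀ j i, ((A0 j).mulVec (Hm j)) i ≤ b0 j i}

/-- A sequence of vectors whose pairing with `a` increases by between `lo` and `hi` at each step
drifts by between `n * lo` and `n * hi` after `n` steps. -/
theorem dotProduct_drift_bounds {ι : Type*} [Fintype ι] (a : ι → ℝ) (h : ℕ → ι → ℝ) (lo hi : ℝ)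
    (hstep : ∀ s, lo ≤ a ⬝ᵥ (h (s + 1) - h s) ∧ a ⬝ᵥ (h (s + 1) - h s) ≤ hi) (k n : ℕ) :
    n * lo ≤ h (k + n) ⬝ᵥ a - h k ⬝ᵥ a ∧ h (k + n) ⬝ᵥ a - h k ⬝ᵥ a ≤ n * hi := by
  induction n with
  | zero => simp
  | succ n ih =>
    have hs := hstep (k + n)
    rw [dotProduct_sub, dotProduct_comm a, dotProduct_comm a] at hs
    push_cast
    rw [← add_assoc]
    constructor <;> linarith [ih.1, ih.2, hs.1, hs.2]

/-- Lemma 2: for every `t ≥ 1` and every subset `W ⊆ {1,…,t}` of retained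
measurement indices, the feasible parameter set `Ω ∩ ⋂_{k∈W} S_k(t)` contains the true
parameter matrix `H t`; in particular, it is nonempty. -/
theorem stmt_3
    (ny m : ℕ) (hny : 0 < ny) (hm : 0 < m)
    (H : ℕ → Matrix (Fin ny) (Fin m) ℝ)
    (φ : ℕ → Fin m → ℝ)
    (d v : ℕ → Fin ny → ℝ)
    (εd εv : Fin ny → ℝ)
    (hεd : ∀ j, 0 < εd j) (hεv : ∀ j, 0 < εv j)
    (hd : ∀ t j, |d t j| ≤ εd j)
    (hv : ∀ t j, |v t j| ≤ εv j)
    (ytil : ℕ → Fin ny → ℝ)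
    (hytil : ∀ t, ytil t = (H t).mulVec (φ t) + d t + v t)
    (nΔ : Fin ny → ℕ)
    (K : ∀ j, Matrix (Fin (nΔ j)) (Fin m) ℝ)
    (l : ∀ j, Fin (nΔ j) → ℝ)
    (hD : ∀ t j i, ((K j).mulVec (H (t + 1) j - H t j)) i ≤ l j i)
    (θlo θhi : Fin ny → ℕ → ℝ)
    (hθ : ∀ j k (x : Fin m → ℝ), (∀ i, ((K j).mulVec x) i ≤ l j i) →
      θlo j k ≤ φ k ⬝ᵥ x ∧ φ k ⬝ᵥ x ≤ θhi j k)
    (r0 : Fin ny → ℕ)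
    (A0 : ∀ j, Matrix (Fin (r0 j)) (Fin m) ℝ) (b0 : ∀ j, Fin (r0 j) → ℝ)
    (hΩ : ∀ t, H t ∈ OmegaSet A0 b0)
    (t : ℕ) (ht : 1 ≤ t)
    (W : Finset ℕ) (hW : ∀ k ∈ W, 1 ≤ k ∧ k ≤ t) :
    H t ∈ (OmegaSet A0 b0 ∩ ⋂ k ∈ W, Sset φ ytil εd εv θlo θhi k t) ∧
      (OmegaSet A0 b0 ∩ ⋂ k ∈ W, Sset φ ytil εd εv θlo θhi k t).Nonempty := by
  have hmem : H t ∈ OmegaSet A0 b0 ∩ ⋂ k ∈ W, Sset φ ytil εd εv θlo θhi k t := by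
    refine ⟨hΩ t, Set.mem_iInter₂.2 fun k hk j => ?_⟩
    obtain ⟨n, rfl⟩ := Nat.exists_eq_add_of_le (hW k hk).2
    have hdrift := dotProduct_drift_bounds (φ k) (fun s => H s j) (θlo j k) (θhi j k)
      (fun s => hθ j k _ (hD s j)) k n
    have hy : ytil k j = H k j ⬝ᵥ φ k + d k j + v k j := by
      rw [hytil]
      rfl
    have hdk := abs_le.1 (hd k j)
    have hvk := abs_le.1 (hv k j)
    have hcast : ((k + n : ℕ) : ℝ) - k = n := by
      push_cast
      ring
    rw [hcast, hy]
    constructor <;> linarith [hdrift.1, hdrift.2, hdk.1, hdk.2, hvk.1, hvk.2]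
  exact ⟨hmem, ⟨H t, hmem⟩⟩
end

section
/- (Lemma 1, duality reformulation of robust output constraints) Suppose that for each j = 1,…,n_y the polytope P_j := {x ∈ ℝ^m : A_j x ≤ b_j componentwise} is nonempty, where A_j ∈ ℝ^{r_j×m} and b_j ∈ ℝ^{r_j}. Let φ ∈ ℝ^m, C ∈ ℝ^{n_o×n_y} with entries c_{lj}, and d̄, g ∈ ℝ^{n_o}. Then the robust constraint 'C H φ + d̄ ≤ g componentwise for every matrix H ∈ ℝ^{n_y×m} whose rows satisfy H_j ∈ P_j for all j' holds if and only if for every l = 1,…,n_o there exist vectors λ_{l,1} ∈ ℝ^{r_1},…,λ_{l,n_y} ∈ ℝ^{r_{n_y}} such that λ_{l,j} ≥ 0 componentwise, A_jᵀ λ_{l,j} = c_{lj} φ for every j, and ∑_{j=1}^{n_y} b_jᵀ λ_{l,j} ≤ g_l − d̄_l. -/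
open Matrix

/-- **Farkas' lemma** for finitely many linear functionals on a real vector space. -/
theorem farkas_finset {V ι : Type*} [AddCommGroup V] [Module ℝ V] (s : Finset ι)
    (a : ι → V →ₗ[ℝ] ℝ) (c : V →ₗ[ℝ] ℝ) (h : ∀ x, (∀ i ∈ s, a i x ≤ 0) → c x ≤ 0) :
    ∃ w : ι → ℝ, (∀ i, 0 ≤ w i) ∧ c = ∑ i ∈ s, w i • a i := by
  classical
  induction s using Finset.induction_on generalizing a c with
  | empty =>
    refine ⟨0, fun _ => le_rfl, LinearMap.ext fun x => ?_⟩
    have h₁ := h x (by simp)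
    have h₂ := h (-x) (by simp)
    simp only [map_neg] at h₂
    simp only [Finset.sum_empty, LinearMap.zero_apply]
    linarith
  | insert k s hk ih =>
    by_cases hs : ∀ x, (∀ i ∈ s, a i x ≤ 0) → c x ≤ 0
    · obtain ⟨w, hw, hc⟩ := ih a c hs
      refine ⟨Function.update w k 0, fun i => ?_, ?_⟩
      · by_cases hi : i = k
        · simp [hi]
        · simpa [hi] using hw i
      · rw [Finset.sum_insert hk, hc, Function.update_self, zero_smul, zero_add]
        refine Finset.sum_congr rfl fun i hi => ?_
        rw [Function.update_of_ne (ne_of_mem_of_not_mem hi hk)]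
    · push Not at hs
      obtain ⟨x₀, hx₀, hcx₀⟩ := hs
      have hk₀ : 0 < a k x₀ := by
        by_contra! hle
        exact (h x₀ (by simpa using ⟨hle, hx₀⟩)).not_gt hcx₀
      obtain ⟨w, hw, hc⟩ := ih (fun i => a i - (a i x₀ / a k x₀) • a k)
        (c - (c x₀ / a k x₀) • a k) (fun x hx => by
          have hy := h (x - (a k x / a k x₀) • x₀) (by
            intro i hi
            rcases Finset.mem_insert.1 hi with rfl | hi
            · simp [hk₀.ne']
            · have := hx i hi
              simp only [LinearMap.sub_apply, LinearMap.smul_apply, smul_eq_mul, map_sub,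
                map_smul] at this ⊢
              convert this using 1
              ring)
          simp only [LinearMap.sub_apply, LinearMap.smul_apply, smul_eq_mul, map_sub,
            map_smul] at hy ⊢
          convert hy using 1
          ring)
      have hsum : ∑ i ∈ s, w i * (a i x₀ / a k x₀) ≤ 0 :=
        Finset.sum_nonpos fun i hi => mul_nonpos_of_nonneg_of_nonpos (hw i)
          (div_nonpos_of_nonpos_of_nonneg (hx₀ i hi) hk₀.le)
      refine ⟨Function.update w k (c x₀ / a k x₀ - ∑ i ∈ s, w i * (a i x₀ / a k x₀)),
        fun i => ?_, ?_⟩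
      · by_cases hi : i = k
        · subst hi
          rw [Function.update_self]
          have := div_pos hcx₀ hk₀
          linarith
        · simpa [hi] using hw i
      · rw [Finset.sum_insert hk, Function.update_self]
        have hcongr : ∑ i ∈ s, Function.update w k
            (c x₀ / a k x₀ - ∑ i ∈ s, w i * (a i x₀ / a k x₀)) i • a i = ∑ i ∈ s, w i • a i :=
          Finset.sum_congr rfl fun i hi => by
            rw [Function.update_of_ne (ne_of_mem_of_not_mem hi hk)]
        rw [hcongr]
        refine LinearMap.ext fun x => ?_
        have hcx := LinearMap.congr_fun hc x
        simp only [LinearMap.sub_apply, LinearMap.add_apply, LinearMap.sum_apply,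
          LinearMap.smul_apply, smul_eq_mul, mul_sub, Finset.sum_sub_distrib, ← mul_assoc,
          ← Finset.sum_mul] at hcx ⊢
        linear_combination hcx

/-- **Affine Farkas' lemma**: a linear inequality valid on a nonempty polyhedron is a nonnegative
combination of the defining inequalities, up to increasing the right-hand side. -/
theorem affine_farkas {V ι : Type*} [AddCommGroup V] [Module ℝ V] [Fintype ι]
    (a : ι → V →ₗ[ℝ] ℝ) (b : ι → ℝ) (c : V →ₗ[ℝ] ℝ) (d : ℝ)
    (hne : ∃ x, ∀ i, a i x ≤ b i) (h : ∀ x, (∀ i, a i x ≤ b i) → c x ≤ d) :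
    ∃ w : ι → ℝ, (∀ i, 0 ≤ w i) ∧ c = ∑ i, w i • a i ∧ ∑ i, w i * b i ≤ d := by
  obtain ⟨x₀, hx₀⟩ := hne
  obtain ⟨w, hw, hc⟩ := farkas_finset (V := V × ℝ) (Finset.univ : Finset (Option ι))
    (fun o => o.elim (-LinearMap.snd ℝ V ℝ)
      fun i => a i ∘ₗ LinearMap.fst ℝ V ℝ - b i • LinearMap.snd ℝ V ℝ)
    (c ∘ₗ LinearMap.fst ℝ V ℝ - d • LinearMap.snd ℝ V ℝ) (by
      rintro ⟨x, t⟩ hx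
      have ht : 0 ≤ t := by simpa using hx none (Finset.mem_univ _)
      have hxi : ∀ i, a i x ≤ b i * t := fun i => by
        simpa using hx (some i) (Finset.mem_univ _)
      suffices c x ≤ d * t by simpa using this
      rcases ht.eq_or_lt with rfl | ht
      · simp only [mul_zero] at hxi ⊢
        by_contra! hpos
        have hs : 0 ≤ (d - c x₀ + 1) / c x :=
          div_nonneg (by linarith [h x₀ hx₀]) hpos.le
        have hle := h (x₀ + ((d - c x₀ + 1) / c x) • x) fun i => by
          have := mul_nonpos_of_nonneg_of_nonpos hs (hxi i)
          simp only [map_add, map_smul, smul_eq_mul]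
          linarith [hx₀ i]
        simp only [map_add, map_smul, smul_eq_mul, div_mul_cancel₀ _ hpos.ne'] at hle
        linarith
      · have hle := h (t⁻¹ • x) fun i => by
          simpa [inv_mul_le_iff₀ ht, mul_comm] using hxi i
        simpa [inv_mul_le_iff₀ ht, mul_comm] using hle)
  refine ⟨fun i => w (some i), fun i => hw _, LinearMap.ext fun x => ?_, ?_⟩
  · simpa [Fintype.sum_option, LinearMap.sum_apply] using LinearMap.congr_fun hc (x, 0)
  · have := LinearMap.congr_fun hc (0, 1)
    simp [Fintype.sum_option, LinearMap.sum_apply] at this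
    linarith [hw none]

/-- Lemma 1, duality reformulation of robust output constraints.
Suppose each polytope `P_j = {x : A_j x ≤ b_j}` is nonempty. Then the robust constraint
`C H φ + d̄ ≤ g` for every `H` with rows `H_j ∈ P_j` holds iff for every `l` there exist
componentwise-nonnegative multipliers `λ_{l,j}` with `A_jᵀ λ_{l,j} = c_{lj} φ` for every `j`
and `∑_j b_jᵀ λ_{l,j} ≤ g_l − d̄_l`. -/
theorem stmt_4
    (ny m no : ℕ) (hny : 0 < ny) (hm : 0 < m) (hno : 0 < no)
    (r : Fin ny → ℕ)
    (A : ∀ j, Matrix (Fin (r j)) (Fin m) ℝ)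
    (b : ∀ j, Fin (r j) → ℝ)
    (hP : ∀ j, ∃ x : Fin m → ℝ, ∀ i, ((A j).mulVec x) i ≤ b j i)
    (φ : Fin m → ℝ)
    (C : Matrix (Fin no) (Fin ny) ℝ)
    (dbar g : Fin no → ℝ) :
    (∀ Hm : Matrix (Fin ny) (Fin m) ℝ,
        (∀ j i, ((A j).mulVec (Hm j)) i ≤ b j i) →
        ∀ l, (∑ j, C l j * (Hm j ⬝ᵥ φ)) + dbar l ≤ g l) ↔
      (∀ l, ∃ lam : ∀ j, Fin (r j) → ℝ,
        (∀ j i, 0 ≤ lam j i) ∧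
        (∀ j, (A j)ᵀ.mulVec (lam j) = C l j • φ) ∧
        (∑ j, b j ⬝ᵥ lam j) ≤ g l - dbar l) := by
  constructor
  · intro h l
    obtain ⟨w, hw, hc, hd⟩ := affine_farkas (V := Fin ny → Fin m → ℝ)
      (ι := Σ j, Fin (r j))
      (fun p => LinearMap.proj p.2 ∘ₗ (A p.1).mulVecLin ∘ₗ LinearMap.proj p.1)
      (fun p => b p.1 p.2)
      (∑ j, C l j • (dotProductBilin ℝ ℝ φ ∘ₗ LinearMap.proj j)) (g l - dbar l)
      (by
        choose x hx using hP
        exact ⟨x, fun p => hx p.1 p.2⟩)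
      (fun x hx => by
        have := h x (fun j i => hx ⟨j, i⟩) l
        simp only [LinearMap.sum_apply, LinearMap.smul_apply, LinearMap.comp_apply,
          LinearMap.proj_apply, dotProductBilin_apply_apply, smul_eq_mul, dotProduct_comm φ]
        linarith)
    refine ⟨fun j i => w ⟨j, i⟩, fun j i => hw _, fun j => funext fun k => ?_, ?_⟩
    · have := LinearMap.congr_fun hc (Pi.single j (Pi.single k 1))
      simp only [LinearMap.sum_apply, Fintype.sum_sigma, LinearMap.smul_apply,
        LinearMap.comp_apply, LinearMap.proj_apply, dotProductBilin_apply_apply, smul_eq_mul,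
        mulVecLin_apply] at this
      rw [Fintype.sum_eq_single j fun i hi => by simp [hi],
        Fintype.sum_eq_single j fun i hi => by simp [hi]] at this
      rw [Pi.single_eq_same, mulVec_single_one, dotProduct_single_one] at this
      simpa [mulVec, dotProduct, mul_comm] using this.symm
    · simpa [Fintype.sum_sigma, dotProduct, mul_comm] using hd
  · intro h Hm hH l
    obtain ⟨lam, hlam, heq, hle⟩ := h l
    have key : ∀ j, C l j * (Hm j ⬝ᵥ φ) ≤ b j ⬝ᵥ lam j := fun j => by
      rw [← smul_eq_mul, ← dotProduct_smul, ← heq j, mulVec_transpose, dotProduct_comm,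
        ← dotProduct_mulVec, dotProduct_comm]
      exact dotProduct_le_dotProduct_of_nonneg_right (hH j) (hlam j)
    linarith [Finset.sum_le_sum fun j (_ : j ∈ Finset.univ) => key j]
end

section
/- For every t ≥ 1, the true parameter matrix at time t+1 belongs to the one-step-ahead predicted feasible parameter set computed from data up to time t: H(t+1) ∈ F(t+1|t). -/
open Matrix

/-- The retained-measurement window `W(k,t) = {i : 1 ≤ i ≤ t, k − i < M/2}`. -/
def Wwin (M k t : ℕ) : Set ℕ := {i | 1 ≤ i ∧ i ≤ t ∧ k - i < M / 2}

/-- The predicted feasible parameter set `F(k|t)`: equal to `Ω` at the end of the horizon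
(`k = t + N`), and to `Ω ∩ ⋂_{i ∈ W(k,t)} S_i(k)` for `t+1 ≤ k ≤ t+N−1`. -/
def Fpred {ny m : ℕ} {r0 : Fin ny → ℕ}
    (A0 : ∀ j, Matrix (Fin (r0 j)) (Fin m) ℝ) (b0 : ∀ j, Fin (r0 j) → ℝ)
    (φ : ℕ → Fin m → ℝ) (ytil : ℕ → Fin ny → ℝ)
    (εd εv : Fin ny → ℝ) (θlo θhi : Fin ny → ℕ → ℝ)
    (M N k t : ℕ) : Set (Matrix (Fin ny) (Fin m) ℝ) :=
  if k = t + N then OmegaSet A0 b0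
  else OmegaSet A0 b0 ∩ ⋂ i ∈ Wwin M k t, Sset φ ytil εd εv θlo θhi i k

/-- If every one-step increment of `x`, paired with `w`, lies in `[a, b]`, then the increment over
`n` steps, paired with `w`, lies in `[n * a, n * b]`. -/
theorem dotProduct_add_sub_mem_Icc {m : ℕ} (x : ℕ → Fin m → ℝ) (w : Fin m → ℝ) {a b : ℝ}
    (h : ∀ t, a ≤ w ⬝ᵥ (x (t + 1) - x t) ∧ w ⬝ᵥ (x (t + 1) - x t) ≤ b) (i n : ℕ) :
    n * a ≤ x (i + n) ⬝ᵥ w - x i ⬝ᵥ w ∧ x (i + n) ⬝ᵥ w - x i ⬝ᵥ w ≤ n * b := by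
  induction n with
  | zero => simp
  | succ n ih =>
    have hstep := h (i + n)
    rw [dotProduct_comm, sub_dotProduct] at hstep
    rw [← add_assoc]
    push_cast
    constructor <;> linarith [ih.1, ih.2, hstep.1, hstep.2]

/-- for every `t ≥ 1`, the true parameter matrix at time `t+1` belongs to the
one-step-ahead predicted feasible parameter set computed from data up to time `t`:
`H(t+1) ∈ F(t+1|t)`. -/
theorem stmt_7
    (ny m : ℕ) (hny : 0 < ny) (hm : 0 < m)
    (H : ℕ → Matrix (Fin ny) (Fin m) ℝ)
    (φ : ℕ → Fin m → ℝ)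
    (d v : ℕ → Fin ny → ℝ)
    (εd εv : Fin ny → ℝ)
    (hεd : ∀ j, 0 < εd j) (hεv : ∀ j, 0 < εv j)
    (hd : ∀ t j, |d t j| ≤ εd j)
    (hv : ∀ t j, |v t j| ≤ εv j)
    (ytil : ℕ → Fin ny → ℝ)
    (hytil : ∀ t, ytil t = (H t).mulVec (φ t) + d t + v t)
    (nΔ : Fin ny → ℕ)
    (K : ∀ j, Matrix (Fin (nΔ j)) (Fin m) ℝ)
    (l : ∀ j, Fin (nΔ j) → ℝ)
    (hD : ∀ t j i, ((K j).mulVec (H (t + 1) j - H t j)) i ≤ l j i)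
    (θlo θhi : Fin ny → ℕ → ℝ)
    (hθ : ∀ j k (x : Fin m → ℝ), (∀ i, ((K j).mulVec x) i ≤ l j i) →
      θlo j k ≤ φ k ⬝ᵥ x ∧ φ k ⬝ᵥ x ≤ θhi j k)
    (r0 : Fin ny → ℕ)
    (A0 : ∀ j, Matrix (Fin (r0 j)) (Fin m) ℝ) (b0 : ∀ j, Fin (r0 j) → ℝ)
    (hΩ : ∀ t, H t ∈ OmegaSet A0 b0)
    (M N : ℕ) (hM : 0 < M) (hMeven : Even M) (hN : 2 ≤ N)
    (t : ℕ) (ht : 1 ≤ t) :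
    H (t + 1) ∈ Fpred A0 b0 φ ytil εd εv θlo θhi M N (t + 1) t := by
  have hS : ∀ i ≤ t, H (t + 1) ∈ Sset φ ytil εd εv θlo θhi i (t + 1) := by
    intro i hi j
    obtain ⟨n, hn⟩ := Nat.exists_eq_add_of_le (hi.trans t.le_succ)
    have hinc := dotProduct_add_sub_mem_Icc (fun s => H s j) (φ i)
      (fun s => hθ j i _ (hD s j)) i n
    have hy : ytil i j = H i j ⬝ᵥ φ i + d i j + v i j := by
      rw [hytil]
      rfl
    have hdj := abs_le.mp (hd i j)
    have hvj := abs_le.mp (hv i j)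
    have hcast : ((t + 1 : ℕ) : ℝ) - i = n := by
      rw [show t + 1 = i + n from hn]
      push_cast
      ring
    rw [hcast, hy, show t + 1 = i + n from hn]
    constructor <;> linarith [hinc.1, hinc.2, hdj.1, hdj.2, hvj.1, hvj.2]
  rw [Fpred, if_neg (by omega)]
  exact ⟨hΩ _, Set.mem_iInter₂.mpr fun i hi => hS i hi.2.1⟩
end

section
/- (One-step recursive feasibility, core of Theorem 1) Assume the zero input increment is admissible, i.e., C_Δu · 0 ≤ g_Δu. Let t ≥ 1, let u(t−1) ∈ ℝ^{n_u} be the previously applied input, and suppose the sequence (u(t|t),…,u(t+N−1|t)) is feasible for the FHOCP at time t with previous input u(t−1) and current regressor φ(t). Apply u(t) := u(t|t), so that φ(t+1) = Fφ(t) + Gu(t). Then the shifted sequence (u(t+1|t),…,u(t+N−1|t), u(t+N−1|t)) is feasible for the FHOCP at time t+1 with previous input u(t) and current regressor φ(t+1). -/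
open Matrix

/-- `predReg Fm G φt useq t s` is the predicted regressor `φ(t+s|t)` obtained from the
current regressor `φt` and the planned input sequence `useq`, via
`φ(t|t) = φt` and `φ(k+1|t) = F φ(k|t) + G u(k|t)`. -/
noncomputable def predReg {m nu : ℕ} (Fm : Matrix (Fin m) (Fin m) ℝ)
    (G : Matrix (Fin m) (Fin nu) ℝ) (φt : Fin m → ℝ)
    (useq : ℕ → Fin nu → ℝ) (t : ℕ) : ℕ → Fin m → ℝ
  | 0 => φt
  | s + 1 => Fm.mulVec (predReg Fm G φt useq t s) + G.mulVec (useq (t + s))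

/-- Feasibility of the input sequence `useq` (indexed by absolute times `t,…,t+N−1`) for the
FHOCP at time `t`, given the previous input `uprev`, the current regressor `φt` and the
predicted feasible parameter sets `Fset k t = F(k|t)`:
(i) input and input-rate constraints on `[t, t+N−1]`;
(ii) robust output constraints `C_y H φ(k|t) + d̄ ≤ g_y` for all `H ∈ F(k|t)`, `k ∈ [t+1, t+N]`;
(iii) terminal equality constraint `φ(t+N|t) = F φ(t+N|t) + G u(t+N−1|t)`. -/
def Feasible {ny m nu ni nDu no : ℕ} (N : ℕ)
    (Fm : Matrix (Fin m) (Fin m) ℝ) (G : Matrix (Fin m) (Fin nu) ℝ)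
    (Cu : Matrix (Fin ni) (Fin nu) ℝ) (CDu : Matrix (Fin nDu) (Fin nu) ℝ)
    (Cy : Matrix (Fin no) (Fin ny) ℝ)
    (gu : Fin ni → ℝ) (gDu : Fin nDu → ℝ) (gy : Fin no → ℝ)
    (dbar : Fin no → ℝ)
    (Fset : ℕ → ℕ → Set (Matrix (Fin ny) (Fin m) ℝ))
    (t : ℕ) (uprev : Fin nu → ℝ) (φt : Fin m → ℝ)
    (useq : ℕ → Fin nu → ℝ) : Prop :=
  (∀ k, t ≤ k → k ≤ t + N - 1 →
      (∀ i, (Cu.mulVec (useq k)) i ≤ gu i) ∧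
      (∀ i, (CDu.mulVec (useq k - if k = t then uprev else useq (k - 1))) i ≤ gDu i)) ∧
  (∀ k, t + 1 ≤ k → k ≤ t + N → ∀ Hm ∈ Fset k t, ∀ l,
      (Cy.mulVec (Hm.mulVec (predReg Fm G φt useq t (k - t)))) l + dbar l ≤ gy l) ∧
  predReg Fm G φt useq t N =
    Fm.mulVec (predReg Fm G φt useq t N) + G.mulVec (useq (t + N - 1))

theorem Wwin_mono_right {M k t t' : ℕ} (h : t ≤ t') : Wwin M k t ⊆ Wwin M k t' :=
  fun _ hi => ⟨hi.1, hi.2.1.trans h, hi.2.2⟩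

theorem Fpred_subset_OmegaSet {ny m : ℕ} {r0 : Fin ny → ℕ}
    (A0 : ∀ j, Matrix (Fin (r0 j)) (Fin m) ℝ) (b0 : ∀ j, Fin (r0 j) → ℝ)
    (φ : ℕ → Fin m → ℝ) (ytil : ℕ → Fin ny → ℝ)
    (εd εv : Fin ny → ℝ) (θlo θhi : Fin ny → ℕ → ℝ) (M N k t : ℕ) :
    Fpred A0 b0 φ ytil εd εv θlo θhi M N k t ⊆ OmegaSet A0 b0 := by
  unfold Fpred
  split_ifs
  · exact subset_rfl
  · exact Set.inter_subset_left

/-- Within the horizon at time `t`, the predicted feasible parameter sets shrink when one more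
measurement is available. -/
theorem Fpred_succ_subset {ny m : ℕ} {r0 : Fin ny → ℕ}
    (A0 : ∀ j, Matrix (Fin (r0 j)) (Fin m) ℝ) (b0 : ∀ j, Fin (r0 j) → ℝ)
    (φ : ℕ → Fin m → ℝ) (ytil : ℕ → Fin ny → ℝ)
    (εd εv : Fin ny → ℝ) (θlo θhi : Fin ny → ℕ → ℝ) {M N k t : ℕ} (hk : k ≤ t + N) :
    Fpred A0 b0 φ ytil εd εv θlo θhi M N k (t + 1) ⊆
      Fpred A0 b0 φ ytil εd εv θlo θhi M N k t := by
  by_cases hkN : k = t + N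
  · rw [show Fpred A0 b0 φ ytil εd εv θlo θhi M N k t = OmegaSet A0 b0 from if_pos hkN]
    exact Fpred_subset_OmegaSet ..
  · unfold Fpred
    rw [if_neg hkN, if_neg (by omega)]
    exact Set.inter_subset_inter_right _
      (Set.biInter_subset_biInter_left (Wwin_mono_right t.le_succ))

/-- Restarting the prediction one step later along the same inputs gives the same regressors. -/
theorem predReg_succ_start {m nu : ℕ} (Fm : Matrix (Fin m) (Fin m) ℝ)
    (G : Matrix (Fin m) (Fin nu) ℝ) (φt : Fin m → ℝ) {u u' : ℕ → Fin nu → ℝ} (t s : ℕ)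
    (hu : ∀ j < s, u' (t + 1 + j) = u (t + 1 + j)) :
    predReg Fm G (Fm.mulVec φt + G.mulVec (u t)) u' (t + 1) s = predReg Fm G φt u t (s + 1) := by
  induction s with
  | zero => rfl
  | succ s ih =>
    rw [predReg, ih fun j hj => hu j (by omega), hu s (by omega), predReg.eq_2 _ _ _ _ _ (s + 1),
      show t + 1 + s = t + (s + 1) by omega]

/-- One-step recursive feasibility, core of Theorem 1. If the zero input
increment is admissible, the sequence `(u(t|t),…,u(t+N−1|t))` is feasible for the FHOCP at
time `t ≥ 1` with previous input `u(t−1)` and regressor `φ(t)`, and `u(t) := u(t|t)` is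
applied so that `φ(t+1) = Fφ(t) + Gu(t)`, then the shifted sequence
`(u(t+1|t),…,u(t+N−1|t),u(t+N−1|t))` is feasible for the FHOCP at time `t+1` with previous
input `u(t)` and regressor `φ(t+1)`. -/
theorem stmt_10
    (ny m nu ni nDu no : ℕ) (hny : 0 < ny) (hm : 0 < m) (hnu : 0 < nu)
    (H : ℕ → Matrix (Fin ny) (Fin m) ℝ)
    (φ : ℕ → Fin m → ℝ)
    (d v : ℕ → Fin ny → ℝ)
    (εd εv : Fin ny → ℝ)
    (hεd : ∀ j, 0 < εd j) (hεv : ∀ j, 0 < εv j)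
    (hd : ∀ t j, |d t j| ≤ εd j)
    (hv : ∀ t j, |v t j| ≤ εv j)
    (ytil : ℕ → Fin ny → ℝ)
    (hytil : ∀ t, ytil t = (H t).mulVec (φ t) + d t + v t)
    (θlo θhi : Fin ny → ℕ → ℝ)
    (r0 : Fin ny → ℕ)
    (A0 : ∀ j, Matrix (Fin (r0 j)) (Fin m) ℝ) (b0 : ∀ j, Fin (r0 j) → ℝ)
    (M N : ℕ) (hM : 0 < M) (hMeven : Even M) (hN : 2 ≤ N)
    (Fm : Matrix (Fin m) (Fin m) ℝ) (G : Matrix (Fin m) (Fin nu) ℝ)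
    (Cu : Matrix (Fin ni) (Fin nu) ℝ) (CDu : Matrix (Fin nDu) (Fin nu) ℝ)
    (Cy : Matrix (Fin no) (Fin ny) ℝ)
    (gu : Fin ni → ℝ) (gDu : Fin nDu → ℝ) (gy : Fin no → ℝ)
    (dbar : Fin no → ℝ)
    (hdbar : ∀ l, dbar l = ∑ j, |Cy l j| * εd j)
    (hzero : ∀ i, (CDu.mulVec 0) i ≤ gDu i)
    (t : ℕ) (ht : 1 ≤ t)
    (uprev : Fin nu → ℝ)
    (useq : ℕ → Fin nu → ℝ)
    (hfeas : Feasible N Fm G Cu CDu Cy gu gDu gy dbar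
      (Fpred A0 b0 φ ytil εd εv θlo θhi M N) t uprev (φ t) useq)
    (hφnext : φ (t + 1) = Fm.mulVec (φ t) + G.mulVec (useq t)) :
    Feasible N Fm G Cu CDu Cy gu gDu gy dbar
      (Fpred A0 b0 φ ytil εd εv θlo θhi M N) (t + 1) (useq t) (φ (t + 1))
      (fun k => if k = t + N then useq (t + N - 1) else useq k) := by
  obtain ⟨hin, hout, hterm⟩ := hfeas
  have hpred : ∀ s, s + 1 ≤ N →
      predReg Fm G (φ (t + 1)) (fun k => if k = t + N then useq (t + N - 1) else useq k) (t + 1) s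
        = predReg Fm G (φ t) useq t (s + 1) := by
    intro s hs
    rw [hφnext]
    exact predReg_succ_start Fm G (φ t) t s fun j hj => if_neg (by omega)
  have hpredN :
      predReg Fm G (φ (t + 1)) (fun k => if k = t + N then useq (t + N - 1) else useq k) (t + 1) N
        = predReg Fm G (φ t) useq t N := by
    obtain ⟨n, rfl⟩ : ∃ n, N = n + 1 := ⟨N - 1, by omega⟩
    rw [predReg, hpred n le_rfl, if_pos (by omega)]
    exact hterm.symm
  refine ⟨fun k hk1 hk2 => ?_, fun k hk1 hk2 Hm hHm l => ?_, ?_⟩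
  · beta_reduce
    by_cases hkN : k = t + N
    · subst hkN
      refine ⟨by simpa using (hin (t + N - 1) (by omega) (by omega)).1, ?_⟩
      rw [if_pos rfl, if_neg (by omega), if_neg (by omega), sub_self]
      exact hzero
    · obtain ⟨h1, h2⟩ := hin k (by omega) (by omega)
      rw [if_neg (by omega)] at h2
      rw [if_neg hkN, if_neg (show k - 1 ≠ t + N by omega)]
      refine ⟨h1, ?_⟩
      split_ifs with hkt
      · simpa [hkt] using h2
      · exact h2
  · by_cases hkN : k = t + N + 1
    · rw [show k - (t + 1) = N by omega, hpredN]
      have h := hout (t + N) (by omega) le_rfl Hm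
        (by rw [Fpred, if_pos rfl]; exact Fpred_subset_OmegaSet _ _ _ _ _ _ _ _ _ _ _ _ hHm) l
      rwa [Nat.add_sub_cancel_left] at h
    · rw [hpred _ (by omega), show k - (t + 1) + 1 = k - t by omega]
      exact hout k (by omega) (by omega) Hm (Fpred_succ_subset _ _ _ _ _ _ _ _ (by omega) hHm) l
  · beta_reduce
    rw [hpredN, if_pos (by omega)]
    exact hterm
end
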